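/- Let m = n and fix a content (k_0,…,k_{N−1}) with k_0 + ⋯ + k_{N−1} = n. Suppose g satisfies both exchange relations: for 1 ≤ i ≤ n−1 and α ≠ β, g(…,ζ_{i+1},ζ_i,…|ξ)^{…,α,β,…}_μ = (ζ_{i+1}/ζ_i)^{N−1}( b(ζ_i/ζ_{i+1}) g(…,ζ_i,ζ_{i+1},…|ξ)^{…,β,α,…}_μ + c_{αβ}(ζ_i/ζ_{i+1}) g(…,ζ_i,ζ_{i+1},…|ξ)^{…,α,β,…}_μ ) and g(ζ|…,ξ_{i+1},ξ_i,…)^{ε}_{…,α,β,…} = (ξ_i/ξ_{i+1})^{N−1}( b(ξ_i/ξ_{i+1}) g(ζ|…,ξ_i,ξ_{i+1},…)^{ε}_{…,β,α,…} + c_{βα}(ξ_i/ξ_{i+1}) g(ζ|…,ξ_i,ξ_{i+1},…)^{ε}_{…,α,β,…} ), together with the equal-index cases g(swapped args)^{…,α,α,…} = (ratio)^{N−1} g(original args)^{…,α,α,…} on both sides. Then for all ζ, ξ with the ζ_a^N pairwise distinct, the ξ_a^N pairwise distinct, and q²(ζ_a/ζ_b)^N ≠ 1, q²(ξ_a/ξ_b)^N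 ≠ 1 for a ≠ b: det( g(ζ|ξ)^{ε}_{μ} )_{ε,μ} = ( ∏_{1≤i<j≤n} a_1(ζ_i/ζ_j) a_2(ξ_i/ξ_j) )^{n(k_0,…,k_{N−1})} · det( f(ζ_{M_0},…,ζ_{M_{N−1}} | ξ_{L_0},…,ξ_{L_{N−1}}) )_{M,L}, where both determinants are over sequences of content (k_0,…,k_{N−1}) (equivalently ordered partitions, rows and columns in the same fixed order under the bijection ε ↔ M), f(ζ'|ξ') := g(ζ'|ξ')^{ε⁰}_{ε⁰} is the extremal component, a_1(ζ) = q^{−1}ζ^{N−1}(1−q²ζ^N)/(1−ζ^N), a_2(ζ) = q^{−1}ζ^{1−N}(1−q²ζ^N)/(1−ζ^N), and n(k_0,…,k_{N−1}) = Σ_{0≤l<r≤N−1} ∏_{j=0}^{N−2} C(n−2−(k'_0+⋯+k'_{j−1}), k'_j), with (k'_0,…,k'_{N−1}) obtained from (k_0,…,k_{N−1}) by decreasing k_l and k_r each by 1, and C(a,b) = 0 if b < 0 or b > a. -/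

import Mathlib

open scoped BigOperators

/-- `b(ζ) = q(1-ζ^N)/(1-q²ζ^N)`. -/
noncomputable def bFun (N : ℕ) (q ζ : ℂ) : ℂ := q * (1 - ζ ^ N) / (1 - q ^ 2 * ζ ^ N)

/-- `c_{jk}(ζ) = (1-q²) ζ^{Nθ(k-j)+j-k}/(1-q²ζ^N)` where `θ(s)=1` iff `s ≥ 0`. -/
noncomputable def cFun (N : ℕ) (q : ℂ) (j k : Fin N) (ζ : ℂ) : ℂ :=
  (1 - q ^ 2) * ζ ^ ((N : ℤ) * (if j ≤ k then 1 else 0) + (j : ℤ) - (k : ℤ))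
    / (1 - q ^ 2 * ζ ^ N)

/-- `a_1(ζ) = q⁻¹ ζ^{N-1} (1-q²ζ^N)/(1-ζ^N)`. -/
noncomputable def a1Fun (N : ℕ) (q ζ : ℂ) : ℂ :=
  q⁻¹ * ζ ^ (N - 1) * (1 - q ^ 2 * ζ ^ N) / (1 - ζ ^ N)

/-- `a_2(ζ) = q⁻¹ ζ^{1-N} (1-q²ζ^N)/(1-ζ^N)`. -/
noncomputable def a2Fun (N : ℕ) (q ζ : ℂ) : ℂ :=
  q⁻¹ * ζ ^ (1 - (N : ℤ)) * (1 - q ^ 2 * ζ ^ N) / (1 - ζ ^ N)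

/-- A sequence `ε` has content `(k_0,…,k_{N-1})` iff `#{a : ε a = r} = k r` for all `r`. -/
def hasContent {m N : ℕ} (ε : Fin m → Fin N) (k : Fin N → ℕ) : Prop :=
  ∀ r : Fin N, (Finset.univ.filter fun a => ε a = r).card = k r

instance {m N : ℕ} (ε : Fin m → Fin N) (k : Fin N → ℕ) : Decidable (hasContent ε k) := by
  unfold hasContent; infer_instance

/-- Lexicographic order on sequences, comparing from the left. -/
def lexLE {m N : ℕ} (a b : Fin m → Fin N) : Prop :=
  a = b ∨ ∃ i : Fin m, (∀ j : Fin m, j < i → a j = b j) ∧ a i < b i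

instance {m N : ℕ} (a b : Fin m → Fin N) : Decidable (lexLE a b) := by
  unfold lexLE; infer_instance

/-- The minimal sequence `ε⁰ = (0^{k_0},1^{k_1},…,(N-1)^{k_{N-1}})` of content `k`:
position `a` belongs to the block determined by the partial sums of `k`. -/
def minSeq (N m : ℕ) (hN : 0 < N) (k : Fin N → ℕ) (a : Fin m) : Fin N :=
  ⟨(Finset.univ.filter fun r : Fin N => (∑ r' ∈ Finset.Iic r, k r') ≤ (a : ℕ)).card % N,
    Nat.mod_lt _ hN⟩

/-- Binomial coefficient with integer arguments, vanishing when `b < 0` or `b > a`. -/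
def binomZ (a b : ℤ) : ℕ := if 0 ≤ b ∧ b ≤ a then Nat.choose a.toNat b.toNat else 0

/-- `n(k_0,…,k_{N-1}) = Σ_{0≤l<r≤N-1} ∏_{j=0}^{N-2} C(n-2-(k'_0+⋯+k'_{j-1}), k'_j)`,
where `k'` is `k` with `k_l` and `k_r` decreased by `1`. -/
def nExp (N n : ℕ) (k : Fin N → ℕ) : ℕ :=
  ∑ l : Fin N, ∑ r : Fin N,
    if l < r then
      ∏ j : Fin N,
        if (j : ℕ) < N - 1 then
          binomZ
            ((n : ℤ) - 2 - ∑ i : Fin N,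
              if i < j then
                (k i : ℤ) - (if i = l then 1 else 0) - (if i = r then 1 else 0)
              else 0)
            ((k j : ℤ) - (if j = l then 1 else 0) - (if j = r then 1 else 0))
        else 1
    else 0

section Dominance

variable {n N : ℕ}

/-- The number of positions before `p` at which `δ` takes a value at least `r`. -/
def upCount (δ : Fin n → Fin N) (p : ℕ) (r : Fin N) : ℕ :=
  (Finset.univ.filter fun a : Fin n => (a : ℕ) < p ∧ r ≤ δ a).card

/-- Dominance (Bruhat) comparison of sequences through their counting functions. -/
def Dominated (δ ε : Fin n → Fin N) : Prop :=
  ∀ p r, upCount δ p r ≤ upCount ε p r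

/-- A weight that is strictly monotone for dominance. -/
def upWeight (δ : Fin n → Fin N) : ℕ :=
  ∑ a : Fin n, ∑ r : Fin N, (upCount δ a r + upCount δ (a + 1) r)

theorem upCount_succ (δ : Fin n → Fin N) (a : Fin n) (r : Fin N) :
    upCount δ (a + 1) r = upCount δ a r + if r ≤ δ a then 1 else 0 := by
  unfold upCount
  split_ifs with h
  · rw [← Finset.card_insert_of_notMem (a := a) (by simp)]
    congr 1
    ext b
    simp only [Finset.mem_filter, Finset.mem_univ, true_and, Finset.mem_insert, Fin.ext_iff]
    constructor
    · rintro ⟨h1, h2⟩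
      by_cases hb : (b : ℕ) = a
      · exact Or.inl hb
      · exact Or.inr ⟨by omega, h2⟩
    · rintro (hb | ⟨h1, h2⟩)
      · obtain rfl := Fin.ext hb
        exact ⟨by omega, h⟩
      · exact ⟨by omega, h2⟩
  · rw [add_zero]
    congr 1
    ext b
    simp only [Finset.mem_filter, Finset.mem_univ, true_and]
    constructor
    · rintro ⟨h1, h2⟩
      refine ⟨?_, h2⟩
      by_contra hb
      obtain rfl : b = a := Fin.ext (by omega)
      exact h h2
    · rintro ⟨h1, h2⟩
      exact ⟨by omega, h2⟩

theorem val_swap_lt_iff {i j : Fin n} (hij : (j : ℕ) = i + 1) {p : ℕ} (hp : p ≠ i + 1)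
    (a : Fin n) : ((Equiv.swap i j a : Fin n) : ℕ) < p ↔ (a : ℕ) < p := by
  rw [Equiv.swap_apply_def]
  split_ifs with h1 h2
  · subst h1; omega
  · subst h2; omega
  · rfl

theorem upCount_comp_swap (δ : Fin n → Fin N) {i j : Fin n} (hij : (j : ℕ) = i + 1) {p : ℕ}
    (hp : p ≠ i + 1) (r : Fin N) : upCount (δ ∘ Equiv.swap i j) p r = upCount δ p r := by
  unfold upCount
  refine Finset.card_equiv (Equiv.swap i j) fun a => ?_
  simp [val_swap_lt_iff hij hp]

theorem upCount_comp_swap_succ (δ : Fin n → Fin N) {i j : Fin n} (hij : (j : ℕ) = i + 1)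
    (r : Fin N) : upCount (δ ∘ Equiv.swap i j) (i + 1) r
      = upCount δ i r + if r ≤ δ j then 1 else 0 := by
  rw [upCount_succ, upCount_comp_swap δ hij (by omega)]
  simp

theorem Dominated.refl (δ : Fin n → Fin N) : Dominated δ δ := fun _ _ => le_rfl

theorem Dominated.trans {δ ε η : Fin n → Fin N} (h : Dominated δ ε) (h' : Dominated ε η) :
    Dominated δ η := fun p r => (h p r).trans (h' p r)

theorem eq_of_upCount_eq {δ ε : Fin n → Fin N}
    (h : ∀ (a : Fin n) r, upCount δ a r = upCount ε a r ∧
      upCount δ (a + 1) r = upCount ε (a + 1) r) : δ = ε := by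
  funext a
  have key : ∀ r, r ≤ δ a ↔ r ≤ ε a := by
    intro r
    have h1 := (h a r).1
    have h2 := (h a r).2
    rw [upCount_succ, upCount_succ] at h2
    split_ifs at h2 <;> first | tauto | omega
  exact le_antisymm ((key _).1 le_rfl) ((key _).2 le_rfl)

theorem Dominated.antisymm {δ ε : Fin n → Fin N} (h : Dominated δ ε) (h' : Dominated ε δ) :
    δ = ε :=
  eq_of_upCount_eq fun _ _ => ⟨(h _ _).antisymm (h' _ _), (h _ _).antisymm (h' _ _)⟩

theorem Dominated.upWeight_lt {δ ε : Fin n → Fin N} (h : Dominated δ ε) (hne : δ ≠ ε) :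
    upWeight δ < upWeight ε := by
  have hle : ∀ a : Fin n, ∀ r : Fin N, upCount δ a r + upCount δ (a + 1) r
      ≤ upCount ε a r + upCount ε (a + 1) r := fun a r => add_le_add (h _ _) (h _ _)
  by_contra hlt
  refine hne (eq_of_upCount_eq fun a r => ?_)
  have hsum : upWeight δ = upWeight ε :=
    le_antisymm (Finset.sum_le_sum fun a _ => Finset.sum_le_sum fun r _ => hle a r) (not_lt.1 hlt)
  have h1 := (Finset.sum_eq_sum_iff_of_le
    (fun a _ => Finset.sum_le_sum fun r _ => hle a r)).1 hsum a (Finset.mem_univ _)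
  have h2 := (Finset.sum_eq_sum_iff_of_le (fun r _ => hle a r)).1 h1 r (Finset.mem_univ _)
  have h3 := h a r
  have h4 := h (a + 1) r
  omega

theorem dominated_comp_swap {ε : Fin n → Fin N} {i j : Fin n} (hij : (j : ℕ) = i + 1)
    (hlt : ε j < ε i) : Dominated (ε ∘ Equiv.swap i j) ε := by
  intro p r
  by_cases hp : p = i + 1
  · subst hp
    rw [upCount_comp_swap_succ ε hij, upCount_succ]
    have : r ≤ ε j → r ≤ ε i := fun h => h.trans hlt.le
    split_ifs <;> omega
  · rw [upCount_comp_swap ε hij hp]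

/-- The lifting property of the dominance order at a descent. -/
theorem Dominated.comp_swap {δ ε : Fin n → Fin N} {i j : Fin n} (hij : (j : ℕ) = i + 1)
    (hlt : ε j < ε i) (h : Dominated δ (ε ∘ Equiv.swap i j)) :
    Dominated (δ ∘ Equiv.swap i j) ε := by
  intro p r
  have h' := h.trans (dominated_comp_swap hij hlt)
  by_cases hp : p = i + 1
  · subst hp
    rw [upCount_comp_swap_succ δ hij, upCount_succ]
    have e1 := h' i r
    have e2 := h' (j + 1) r
    rw [upCount_succ, upCount_succ, hij, upCount_succ, upCount_succ] at e2
    have : r ≤ ε j → r ≤ ε i := fun h => h.trans hlt.le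
    split_ifs at * <;> omega
  · rw [upCount_comp_swap δ hij hp]
    exact h' p r

end Dominance

section Sorting

variable {n N : ℕ}

theorem swap_lt_swap_of_ne {i j : Fin n} (hij : (j : ℕ) = i + 1) {a b : Fin n} (hab : a < b)
    (h : ¬ (a = i ∧ b = j)) : Equiv.swap i j a < Equiv.swap i j b := by
  simp only [Equiv.swap_apply_def]
  split_ifs <;> simp only [Fin.lt_def, Fin.ext_iff] at * <;> omega

theorem sort_comp_swap_of_ne (δ : Fin n → Fin N) {i j : Fin n} (hij : (j : ℕ) = i + 1)
    (hne : δ i ≠ δ j) :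
    Tuple.sort (δ ∘ Equiv.swap i j) = Equiv.swap i j * Tuple.sort δ := by
  symm
  rw [Tuple.eq_sort_iff]
  have hs := (Tuple.eq_sort_iff (f := δ) (σ := Tuple.sort δ)).1 rfl
  constructor
  · convert hs.1 using 1
    ext a
    simp
  · intro a b hab h
    simp only [Equiv.Perm.coe_mul, Function.comp_apply, Equiv.swap_apply_self] at h ⊢
    refine swap_lt_swap_of_ne hij (hs.2 a b hab h) ?_
    rintro ⟨h1, h2⟩
    rw [h1, h2] at h
    exact hne h

theorem swap_mul_sort_of_eq (δ : Fin n → Fin N) {i j : Fin n} (hij : (j : ℕ) = i + 1)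
    (heq : δ i = δ j) :
    ∃ t u : Fin n, (u : ℕ) = t + 1 ∧ Tuple.sort δ t = i ∧ Tuple.sort δ u = j ∧
      Equiv.swap i j * Tuple.sort δ = Tuple.sort δ * Equiv.swap t u := by
  have hs := (Tuple.eq_sort_iff (f := δ) (σ := Tuple.sort δ)).1 rfl
  generalize Tuple.sort δ = σ at *
  have h1 : σ (σ⁻¹ i) = i := by simp
  have h2 : σ (σ⁻¹ j) = j := by simp
  refine ⟨σ⁻¹ i, σ⁻¹ j, ?_, h1, h2, Equiv.swap_mul_eq_mul_swap σ i j⟩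
  generalize σ⁻¹ i = t at *
  generalize σ⁻¹ j = u at *
  have htu : t < u := by
    rcases lt_trichotomy t u with h | h | h
    · exact h
    · subst h
      rw [h1] at h2
      rw [h2] at hij
      omega
    · have := hs.2 u t h (by rw [h1, h2, heq])
      rw [h1, h2, Fin.lt_def] at this
      omega
  by_contra hcon
  have hlt : (t : ℕ) + 1 < u := by
    rw [Fin.lt_def] at htu
    omega
  let v : Fin n := ⟨t + 1, by omega⟩
  have htv : t < v := by simp [v, Fin.lt_def]
  have hvu : v < u := by simpa [v, Fin.lt_def] using hlt
  have hv : δ (σ v) = δ i :=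
    le_antisymm (by simpa [h2, heq] using hs.1 hvu.le) (by simpa [h1] using hs.1 htv.le)
  have a1 := hs.2 t v htv (by rw [h1, hv])
  have a2 := hs.2 v u hvu (by rw [h2, hv, heq])
  rw [h1, Fin.lt_def] at a1
  rw [h2, Fin.lt_def] at a2
  omega

theorem minSeq_eq_comp_sort (hN : 0 < N) (k : Fin N → ℕ) (δ : Fin n → Fin N)
    (hδ : hasContent δ k) : minSeq N n hN k = δ ∘ Tuple.sort δ := by
  have hmono := Tuple.monotone_sort δ
  funext a
  have hsum : ∀ r : Fin N, ∑ r' ∈ Finset.Iic r, k r'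
      = (Finset.univ.filter fun b => (δ ∘ Tuple.sort δ) b ≤ r).card := by
    intro r
    have : (Finset.univ.filter fun b => (δ ∘ Tuple.sort δ) b ≤ r).card
        = (Finset.univ.filter fun b => δ b ≤ r).card :=
      Finset.card_equiv (Tuple.sort δ) fun b => by simp
    rw [this, Finset.card_eq_sum_card_fiberwise (f := δ) (t := Finset.Iic r)
      (fun b hb => by simpa using hb)]
    refine Finset.sum_congr rfl fun r' hr' => ?_
    rw [← hδ r', Finset.filter_filter]
    congr 1
    ext b
    simp only [Finset.mem_filter, Finset.mem_univ, true_and, Finset.mem_Iic] at hr' ⊢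
    constructor
    · rintro rfl
      exact ⟨hr', rfl⟩
    · exact fun h => h.2
  have hset : (Finset.univ.filter fun r : Fin N => (∑ r' ∈ Finset.Iic r, k r') ≤ (a : ℕ))
      = Finset.Iio ((δ ∘ Tuple.sort δ) a) := by
    ext r
    have := Tuple.lt_card_le_iff_apply_le_of_monotone (a := r) (j := a) hmono
    simp only [Finset.mem_filter, Finset.mem_univ, true_and, Finset.mem_Iio, hsum]
    rw [← not_lt, this, not_le]
  apply Fin.ext
  simp only [minSeq]
  rw [hset, Fin.card_Iio, Nat.mod_eq_of_lt (Fin.is_lt _)]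

theorem hasContent.comp_perm {k : Fin N → ℕ} {δ : Fin n → Fin N} (hδ : hasContent δ k)
    (σ : Equiv.Perm (Fin n)) : hasContent (δ ∘ σ) k := by
  intro r
  rw [← hδ r]
  exact Finset.card_equiv σ fun b => by simp

theorem exists_descent {ε : Fin n → Fin N} (h : ¬ Monotone ε) :
    ∃ i j : Fin n, (j : ℕ) = i + 1 ∧ ε j < ε i := by
  cases n with
  | zero => exact absurd (fun a => a.elim0) h
  | succ m =>
    rw [Fin.monotone_iff_le_succ] at h
    push Not at h
    obtain ⟨i, hi⟩ := h
    exact ⟨i.castSucc, i.succ, by simp, hi⟩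

end Sorting

section Expansion

variable {n N : ℕ}

/-- `h` satisfies an exchange relation on `G`: a descent of the index sequence is resolved with
coefficients `A` and `C`, and swapping the arguments of two equal indices gives the factor `S`. -/
def IsExchange (A : ℂ → ℂ → ℂ) (C : Fin N → Fin N → ℂ → ℂ → ℂ) (S : ℂ → ℂ → ℂ)
    (G : Set (Fin n → ℂ)) (h : (Fin n → ℂ) → (Fin n → Fin N) → ℂ) : Prop :=
  ∀ ζ ∈ G, ∀ i j : Fin n, (j : ℕ) = i + 1 → ∀ ε : Fin n → Fin N,
    (ε j < ε i → h ζ ε = A (ζ i) (ζ j) * h (ζ ∘ Equiv.swap i j) (ε ∘ Equiv.swap i j)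
      + C (ε j) (ε i) (ζ i) (ζ j) * h ζ (ε ∘ Equiv.swap i j)) ∧
    (ε i = ε j → h (ζ ∘ Equiv.swap i j) ε = S (ζ i) (ζ j) * h ζ ε)

/-- The product of `A` over the inversions of `ε`. -/
noncomputable def inversionProd (A : ℂ → ℂ → ℂ) (ζ : Fin n → ℂ) (ε : Fin n → Fin N) : ℂ :=
  ∏ a : Fin n, ∏ b : Fin n, if a < b ∧ ε b < ε a then A (ζ a) (ζ b) else 1

theorem inversionProd_of_monotone (A : ℂ → ℂ → ℂ) (ζ : Fin n → ℂ) {ε : Fin n → Fin N}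
    (hε : Monotone ε) : inversionProd A ζ ε = 1 := by
  refine Finset.prod_eq_one fun a _ => Finset.prod_eq_one fun b _ => if_neg ?_
  rintro ⟨h1, h2⟩
  exact absurd (hε h1.le) (not_le.2 h2)

theorem inversionProd_eq_mul_swap (A : ℂ → ℂ → ℂ) (ζ : Fin n → ℂ) {ε : Fin n → Fin N}
    {i j : Fin n} (hij : (j : ℕ) = i + 1) (hlt : ε j < ε i) :
    inversionProd A ζ ε = A (ζ i) (ζ j)
      * inversionProd A (ζ ∘ Equiv.swap i j) (ε ∘ Equiv.swap i j) := by
  have h1 : inversionProd A (ζ ∘ Equiv.swap i j) (ε ∘ Equiv.swap i j)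
      = ∏ a : Fin n, ∏ b : Fin n,
        if Equiv.swap i j a < Equiv.swap i j b ∧ ε b < ε a then A (ζ a) (ζ b) else 1 := by
    unfold inversionProd
    refine Fintype.prod_equiv (Equiv.swap i j) _ _ fun a => ?_
    refine Fintype.prod_equiv (Equiv.swap i j) _ _ fun b => ?_
    simp
  have h2 : A (ζ i) (ζ j)
      = ∏ a : Fin n, ∏ b : Fin n, if a = i ∧ b = j then A (ζ a) (ζ b) else 1 := by
    rw [Finset.prod_eq_single i, Finset.prod_eq_single j]
    · simp
    · intro b _ hb
      simp [hb]
    · simp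
    · intro a _ ha
      simp [ha]
    · simp
  rw [h1, h2, ← Finset.prod_mul_distrib]
  refine Finset.prod_congr rfl fun a _ => ?_
  rw [← Finset.prod_mul_distrib]
  refine Finset.prod_congr rfl fun b _ => ?_
  have hlt' : i < j := Fin.lt_def.2 (by omega)
  by_cases hab : a = i ∧ b = j
  · obtain ⟨rfl, rfl⟩ := hab
    simp [hlt', hlt, hlt'.le]
  · rw [if_neg hab, one_mul]
    congr 1
    rw [eq_iff_iff]
    refine and_congr_left fun hba => ⟨fun h => swap_lt_swap_of_ne hij h hab, fun h => ?_⟩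
    have := swap_lt_swap_of_ne hij h (by
      rintro ⟨ha, hb⟩
      obtain rfl : a = j := by rw [← Equiv.swap_apply_self i j a, ha, Equiv.swap_apply_left]
      obtain rfl : b = i := by rw [← Equiv.swap_apply_self i a b, hb, Equiv.swap_apply_right]
      exact absurd hba hlt.asymm)
    simpa using this

/-- The permutation of the sequences of given content by a permutation of positions. -/
def contentPerm (k : Fin N → ℕ) (i j : Fin n) :
    Equiv.Perm {ε : Fin n → Fin N // hasContent ε k} where
  toFun δ := ⟨δ.1 ∘ Equiv.swap i j, δ.2.comp_perm _⟩
  invFun δ := ⟨δ.1 ∘ Equiv.swap i j, δ.2.comp_perm _⟩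
  left_inv δ := Subtype.ext (by ext; simp)
  right_inv δ := Subtype.ext (by ext; simp)

/-- Triangular expansion of a solution of the exchange relation in its minimal component. -/
theorem exists_triangular_expansion (hN : 0 < N) (k : Fin N → ℕ) (A : ℂ → ℂ → ℂ)
    (C : Fin N → Fin N → ℂ → ℂ → ℂ) (S : ℂ → ℂ → ℂ) (G : Set (Fin n → ℂ))
    (hG : ∀ ζ ∈ G, ∀ σ : Equiv.Perm (Fin n), ζ ∘ σ ∈ G)
    (E : {ε : Fin n → Fin N // hasContent ε k}) :
    ∀ ζ ∈ G, ∃ c : {ε : Fin n → Fin N // hasContent ε k} → ℂ,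
      (∀ D, c D ≠ 0 → Dominated D.1 E.1) ∧ c E = inversionProd A ζ E.1 ∧
      ∀ h, IsExchange A C S G h →
        h ζ E.1 = ∑ D, c D * h (ζ ∘ Tuple.sort D.1) (minSeq N n hN k) := by
  induction hw : upWeight E.1 using Nat.strong_induction_on generalizing E with
  | _ w ih =>
  intro ζ hζ
  by_cases hmono : Monotone E.1
  · refine ⟨Pi.single E 1, fun D hD => ?_, ?_, fun h _ => ?_⟩
    · obtain rfl : D = E := by
        by_contra hne
        exact hD (Pi.single_eq_of_ne hne 1)
      exact Dominated.refl _
    · rw [inversionProd_of_monotone A ζ hmono, Pi.single_eq_same]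
    · rw [Finset.sum_eq_single E]
      · rw [minSeq_eq_comp_sort hN k E.1 E.2, Tuple.sort_eq_refl_iff_monotone.2 hmono]
        simp
      · intro D _ hD
        simp [Pi.single_eq_of_ne hD]
      · simp
  · obtain ⟨i, j, hij, hlt⟩ := exists_descent hmono
    set s := contentPerm (n := n) k i j
    have hsE : (s E).1 = E.1 ∘ Equiv.swap i j := rfl
    have hss : ∀ D, s (s D) = D := s.left_inv
    have hdom : Dominated (s E).1 E.1 := dominated_comp_swap hij hlt
    have hne : (s E).1 ≠ E.1 := by
      intro h
      have := congrFun h i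
      rw [hsE, Function.comp_apply, Equiv.swap_apply_left] at this
      exact hlt.ne this
    have hwt : upWeight (s E).1 < w := hw ▸ hdom.upWeight_lt hne
    obtain ⟨c₁, hc₁, hd₁, he₁⟩ := ih _ hwt (s E) rfl (ζ ∘ Equiv.swap i j) (hG ζ hζ _)
    obtain ⟨c₂, hc₂, hd₂, he₂⟩ := ih _ hwt (s E) rfl ζ hζ
    let κ : {ε : Fin n → Fin N // hasContent ε k} → ℂ :=
      fun D => if D.1 i = D.1 j then S (ζ i) (ζ j) else 1
    refine ⟨fun D => A (ζ i) (ζ j) * (κ D * c₁ (s D)) + C (E.1 j) (E.1 i) (ζ i) (ζ j) * c₂ D,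
      fun D hD => ?_, ?_, fun h hh => ?_⟩
    · by_cases h2 : c₂ D = 0
      · have h1 : c₁ (s D) ≠ 0 := by
          intro h1
          exact hD (by simp [h1, h2])
        have := Dominated.comp_swap hij hlt (hc₁ _ h1)
        rwa [show (s D).1 ∘ Equiv.swap i j = D.1 from congrArg Subtype.val (hss D)] at this
      · exact (hc₂ D h2).trans hdom
    · have h2 : c₂ E = 0 := by
        by_contra h2
        exact hne (hdom.antisymm (hc₂ E h2))
      have hκ : κ E = 1 := if_neg hlt.ne'
      simp only [h2, hκ, hd₁]
      rw [inversionProd_eq_mul_swap A ζ hij hlt, hsE]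
      ring
    · have key : ∀ D, h ((ζ ∘ Equiv.swap i j) ∘ Tuple.sort D.1) (minSeq N n hN k)
          = κ (s D) * h (ζ ∘ Tuple.sort (s D).1) (minSeq N n hN k) := by
        intro D
        by_cases hD : D.1 i = D.1 j
        · have hsD : (s D).1 = D.1 := by
            funext a
            change D.1 (Equiv.swap i j a) = D.1 a
            rw [Equiv.swap_apply_def]
            split_ifs with h1 h2
            · rw [h1, hD]
            · rw [h2, hD]
            · rfl
          have hκ : κ (s D) = S (ζ i) (ζ j) := by
            simp only [κ, hsD]
            exact if_pos hD
          obtain ⟨t, u, htu, ht, hu, hcomm⟩ := swap_mul_sort_of_eq D.1 hij hD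
          have := (hh (ζ ∘ Tuple.sort D.1) (hG ζ hζ _) t u htu (minSeq N n hN k)).2 (by
            rw [minSeq_eq_comp_sort hN k D.1 D.2]
            simp [ht, hu, hD])
          rw [hκ, hsD]
          simp only [Function.comp_apply, ht, hu] at this
          rw [← this, Function.comp_assoc, ← Equiv.Perm.coe_mul, hcomm]
          rfl
        · have hκ : κ (s D) = 1 := by
            refine if_neg fun h => hD ?_
            have : D.1 (Equiv.swap i j i) = D.1 (Equiv.swap i j j) := h
            simpa using this.symm
          rw [hκ, one_mul]
          congr 1
          change _ = ζ ∘ Tuple.sort (D.1 ∘ Equiv.swap i j)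
          rw [sort_comp_swap_of_ne D.1 hij hD]
          rfl
      have hsum : ∑ D, c₁ D * h ((ζ ∘ Equiv.swap i j) ∘ Tuple.sort D.1) (minSeq N n hN k)
          = ∑ D, κ D * c₁ (s D) * h (ζ ∘ Tuple.sort D.1) (minSeq N n hN k) := by
        refine Fintype.sum_equiv s _ _ fun D => ?_
        rw [key, hss]
        ring
      have e1 := he₁ h hh
      have e2 := he₂ h hh
      rw [hsE] at e1 e2
      rw [(hh ζ hζ i j hij E.1).1 hlt, e1, e2, hsum, Finset.mul_sum, Finset.mul_sum,
        ← Finset.sum_add_distrib]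
      refine Finset.sum_congr rfl fun D _ => ?_
      ring

theorem det_of_dominated {k : Fin N → ℕ}
    (T : Matrix {ε : Fin n → Fin N // hasContent ε k} {ε : Fin n → Fin N // hasContent ε k} ℂ)
    (hT : ∀ E D, T E D ≠ 0 → Dominated D.1 E.1) : T.det = ∏ E, T E E := by
  rw [Matrix.det_apply, Finset.sum_eq_single 1]
  · simp
  · intro σ _ hσ
    have : ∏ E, T (σ E) E = 0 := by
      by_contra hprod
      rw [← ne_eq, Finset.prod_ne_zero_iff] at hprod
      have hdom : ∀ E, Dominated E.1 (σ E).1 := fun E => hT _ _ (hprod E (Finset.mem_univ _))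
      have hle : ∀ E, upWeight E.1 ≤ upWeight (σ E).1 := by
        intro E
        by_cases h : E.1 = (σ E).1
        · rw [← h]
        · exact ((hdom E).upWeight_lt h).le
      have hsum : ∑ E, upWeight (E : {ε : Fin n → Fin N // hasContent ε k}).1
          = ∑ E, upWeight (σ E).1 :=
        (Equiv.sum_comp σ fun E => upWeight E.1).symm
      rw [Finset.sum_eq_sum_iff_of_le fun E _ => hle E] at hsum
      refine hσ (Equiv.ext fun E => ?_)
      by_contra hE
      refine ((hdom E).upWeight_lt fun h => hE ?_).ne (hsum E (Finset.mem_univ _))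
      exact Subtype.ext h.symm
    rw [this, smul_zero]
  · simp

end Expansion

section Counting

variable {n N : ℕ}

theorem multinomial_eq_prod_choose {α : Type*} [LinearOrder α] (s : Finset α) (f : α → ℕ) :
    Nat.multinomial s f
      = ∏ j ∈ s, (∑ i ∈ s.filter (j ≤ ·), f i).choose (f j) := by
  induction s using Finset.induction_on_min with
  | empty => simp
  | insert a s ha ih =>
    have has : a ∉ s := fun h => lt_irrefl _ (ha a h)
    rw [Nat.multinomial_insert has, Finset.prod_insert has, ih]
    congr 1
    · congr 1
      rw [Finset.filter_true_of_mem, Finset.sum_insert has]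
      intro i hi
      rcases Finset.mem_insert.1 hi with rfl | hi
      · exact le_rfl
      · exact (ha i hi).le
    · refine Finset.prod_congr rfl fun j hj => ?_
      rw [Finset.filter_insert, if_neg (not_le.2 (ha j hj))]

theorem prod_binomZ_eq_multinomial (hN : 0 < N) (m : ℕ) (f : Fin N → ℕ) (hf : ∑ i, f i = m) :
    (∏ j : Fin N, if (j : ℕ) < N - 1 then
        binomZ ((m : ℤ) - ∑ i : Fin N, if i < j then (f i : ℤ) else 0) (f j) else 1)
      = Nat.multinomial Finset.univ f := by
  rw [multinomial_eq_prod_choose]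
  refine Finset.prod_congr rfl fun j _ => ?_
  have hle : f j ≤ ∑ i ∈ Finset.univ.filter (j ≤ ·), f i :=
    Finset.single_le_sum (f := f) (fun _ _ => Nat.zero_le _) (by simp)
  split_ifs with hj
  · have hsub : (m : ℤ) - ∑ i : Fin N, (if i < j then (f i : ℤ) else 0)
        = ((∑ i ∈ Finset.univ.filter (j ≤ ·), f i : ℕ) : ℤ) := by
      rw [← hf, ← Finset.sum_filter, sub_eq_iff_eq_add,
        ← Finset.sum_filter_add_sum_filter_not Finset.univ (j ≤ ·)]
      simp only [not_le]
      push_cast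
      rfl
    rw [hsub, binomZ, if_pos ⟨by positivity, by exact_mod_cast hle⟩,
      Int.toNat_natCast, Int.toNat_natCast]
  · have : Finset.univ.filter (j ≤ ·) = {j} := by
      ext i
      simp only [Finset.mem_filter, Finset.mem_univ, true_and, Finset.mem_singleton, Fin.le_def,
        Fin.ext_iff]
      omega
    rw [this]
    simp

theorem coeff_prod_X_eq (k : Fin N →₀ ℕ) (x : Fin n → Fin N) :
    MvPolynomial.coeff k (∏ c, (MvPolynomial.X (x c) : MvPolynomial (Fin N) ℕ))
      = if hasContent x k then 1 else 0 := by
  have h : ∏ c, (MvPolynomial.X (x c) : MvPolynomial (Fin N) ℕ)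
      = MvPolynomial.monomial (∑ c, Finsupp.single (x c) 1) 1 :=
    (MvPolynomial.monomial_sum_one _ _).symm
  rw [h, MvPolynomial.coeff_monomial]
  congr 1
  rw [eq_iff_iff, Finsupp.ext_iff]
  refine forall_congr' fun r => ?_
  rw [Finsupp.finsetSum_apply, Finset.card_filter]
  simp [Finsupp.single_apply]

theorem sum_sub_indicators (k : Fin N → ℕ) (hk : ∑ r, k r = n) {l r : Fin N} (hlr : l ≠ r)
    (h : k l ≠ 0 ∧ k r ≠ 0) :
    ∑ i, (k i - (if i = l then 1 else 0) - (if i = r then 1 else 0)) = n - 2 := by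
  have h2 : ∑ i, (k i - (if i = l then 1 else 0) - (if i = r then 1 else 0))
      + ∑ i, ((if i = l then 1 else 0) + (if i = r then 1 else 0)) = ∑ i, k i := by
    rw [← Finset.sum_add_distrib]
    refine Finset.sum_congr rfl fun i _ => ?_
    have h3 : i = l → k i ≠ 0 := fun e => e ▸ h.1
    have h4 : i = r → k i ≠ 0 := fun e => e ▸ h.2
    have h5 : i = l → i ≠ r := fun e => e ▸ hlr
    split_ifs <;> omega
  rw [Finset.sum_add_distrib] at h2
  simp only [Finset.sum_ite_eq', Finset.mem_univ, if_true] at h2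
  omega

theorem card_pinned (k : Fin N → ℕ) (hk : ∑ r, k r = n) {a b : Fin n} (hab : a ≠ b)
    {l r : Fin N} (hlr : l ≠ r) :
    (Finset.univ.filter fun E : {ε : Fin n → Fin N // hasContent ε k} =>
        E.1 b = l ∧ E.1 a = r).card
      = if k l ≠ 0 ∧ k r ≠ 0 then Nat.multinomial Finset.univ
          fun i => k i - (if i = l then 1 else 0) - (if i = r then 1 else 0) else 0 := by
  let K : Fin N →₀ ℕ := Finsupp.equivFunOnFinite.symm k
  have hK : ∀ i, K i = k i := fun i => rfl
  let t : Fin n → Finset (Fin N) := fun c => if c = a then {r} else if c = b then {l} else .univ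
  have hpi := Finset.prod_univ_sum t fun _ s => (MvPolynomial.X s : MvPolynomial (Fin N) ℕ)
  have hcard : (Finset.univ.filter fun E : {ε : Fin n → Fin N // hasContent ε k} =>
        E.1 b = l ∧ E.1 a = r).card
      = MvPolynomial.coeff K (∏ c, ∑ s ∈ t c, (MvPolynomial.X s : MvPolynomial (Fin N) ℕ)) := by
    rw [hpi, MvPolynomial.coeff_sum]
    simp only [coeff_prod_X_eq]
    rw [← Finset.card_filter]
    refine Finset.card_bij (fun E _ => E.1) ?_ (fun _ _ _ _ h => Subtype.ext h) ?_
    · rintro ⟨ε, hε⟩ h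
      simp only [Finset.mem_filter, Finset.mem_univ, true_and] at h
      simp only [Finset.mem_filter, Fintype.mem_piFinset]
      refine ⟨fun c => ?_, hε⟩
      simp only [t]
      split_ifs with h1 h2
      · subst h1; simpa using h.2
      · subst h2; simpa using h.1
      · simp
    · intro ε h
      simp only [Finset.mem_filter, Fintype.mem_piFinset] at h
      refine ⟨⟨ε, h.2⟩, ?_, rfl⟩
      have ha := h.1 a
      have hb := h.1 b
      simp only [t, if_true, if_neg hab.symm, Finset.mem_singleton] at ha hb
      simp [ha, hb]
  have hprod : ∏ c, ∑ s ∈ t c, (MvPolynomial.X s : MvPolynomial (Fin N) ℕ)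
      = MvPolynomial.X l * (MvPolynomial.X r * (∑ s, MvPolynomial.X s) ^ (n - 2)) := by
    rw [← Finset.mul_prod_erase _ _ (Finset.mem_univ b),
      ← Finset.mul_prod_erase _ _ (Finset.mem_erase.2 ⟨hab, Finset.mem_univ a⟩)]
    congr 1
    · simp [t, hab.symm]
    congr 1
    · simp [t]
    · rw [Finset.prod_congr rfl (g := fun _ => ∑ s, MvPolynomial.X s), Finset.prod_const,
        Finset.card_erase_of_mem (by simp [hab]), Finset.card_erase_of_mem (by simp)]
      · simp [Nat.sub_sub]
      · intro c hc
        simp only [Finset.mem_erase] at hc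
        simp [t, hc.1, hc.2.1]
  rw [hcard, hprod, MvPolynomial.coeff_X_mul', MvPolynomial.coeff_X_mul']
  have hr : (K - Finsupp.single l 1 : Fin N →₀ ℕ) r = k r := by simp [hK, hlr]
  simp only [Finsupp.mem_support_iff, hr, hK]
  rw [← ite_and]
  refine if_ctx_congr Iff.rfl (fun h => ?_) fun _ => rfl
  have hfun : ∀ i, (K - Finsupp.single l 1 - Finsupp.single r 1 : Fin N →₀ ℕ) i
      = k i - (if i = l then 1 else 0) - (if i = r then 1 else 0) := by
    intro i
    simp [hK, Finsupp.single_apply, eq_comm]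
  have hsum := sum_sub_indicators k hk hlr h
  rw [MvPolynomial.coeff_sum_X_pow_of_fintype, if_pos]
  · rw [Finsupp.multinomial_eq_of_support_subset (Finset.subset_univ _)]
    simp only [Nat.cast_id]
    exact Nat.multinomial_congr fun i _ => hfun i
  · rw [Finsupp.sum_fintype _ _ (fun _ => rfl), ← hsum]
    exact Finset.sum_congr rfl fun i _ => hfun i

theorem card_descents_eq_nExp (hN : 2 ≤ N) (k : Fin N → ℕ) (hk : ∑ r, k r = n) {a b : Fin n}
    (hab : a ≠ b) :
    (Finset.univ.filter fun E : {ε : Fin n → Fin N // hasContent ε k} => E.1 b < E.1 a).card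
      = nExp N n k := by
  have hn : 2 ≤ n := by
    have := Fin.val_ne_of_ne hab
    omega
  have hsplit : (Finset.univ.filter fun E : {ε : Fin n → Fin N // hasContent ε k} =>
        E.1 b < E.1 a).card
      = ∑ l : Fin N, ∑ r : Fin N, if l < r then
        (Finset.univ.filter fun E : {ε : Fin n → Fin N // hasContent ε k} =>
          E.1 b = l ∧ E.1 a = r).card else 0 := by
    rw [Finset.card_eq_sum_card_fiberwise (f := fun E => (E.1 b, E.1 a)) (t := Finset.univ)
      (fun _ _ => Finset.mem_coe.2 (Finset.mem_univ _)), Fintype.sum_prod_type]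
    refine Finset.sum_congr rfl fun l _ => Finset.sum_congr rfl fun r _ => ?_
    rw [Finset.filter_filter]
    simp only [Prod.mk.injEq]
    split_ifs with hlr
    · congr 1
      ext E
      simp only [Finset.mem_filter, Finset.mem_univ, true_and]
      exact ⟨fun h => h.2, fun h => ⟨by rw [h.1, h.2]; exact hlr, h⟩⟩
    · rw [Finset.card_eq_zero, Finset.filter_eq_empty_iff]
      rintro E - ⟨h1, h2, h3⟩
      exact hlr (by rwa [h2, h3] at h1)
  rw [hsplit, nExp]
  refine Finset.sum_congr rfl fun l _ => Finset.sum_congr rfl fun r _ => ?_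
  split_ifs with hlr
  swap
  · rfl
  rw [card_pinned k hk hab hlr.ne]
  split_ifs with hpos
  · rw [← prod_binomZ_eq_multinomial (by omega) (n - 2)]
    · have hcast : ∀ i, ((k i - (if i = l then 1 else 0) - (if i = r then 1 else 0) : ℕ) : ℤ)
          = (k i : ℤ) - (if i = l then 1 else 0) - (if i = r then 1 else 0) := by
        intro i
        have h3 : i = l → k i ≠ 0 := fun e => e ▸ hpos.1
        have h4 : i = r → k i ≠ 0 := fun e => e ▸ hpos.2
        have h5 : i = l → i ≠ r := fun e => e ▸ hlr.ne
        split_ifs <;> omega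
      simp only [hcast]
      push_cast [Nat.cast_sub hn]
      rfl
    · exact sum_sub_indicators k hk hlr.ne hpos
  · symm
    have hlr' : (l : ℕ) < r := hlr
    have hrN : (r : ℕ) < N := r.2
    by_cases hl : k l = 0
    · refine Finset.prod_eq_zero (Finset.mem_univ l) ?_
      rw [if_pos (by omega), binomZ, if_neg]
      simp [hl, hlr.ne]
    have hr : k r = 0 := by tauto
    by_cases hrlast : (r : ℕ) < N - 1
    · refine Finset.prod_eq_zero (Finset.mem_univ r) ?_
      rw [if_pos hrlast, binomZ, if_neg]
      simp [hr, hlr.ne']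
    · let j : Fin N := ⟨N - 2, by omega⟩
      refine Finset.prod_eq_zero (Finset.mem_univ j) ?_
      have hj : (j : ℕ) = N - 2 := rfl
      rw [if_pos (by omega), binomZ, if_neg]
      set f : Fin N → ℤ := fun i => (k i : ℤ) - (if i = l then 1 else 0) - (if i = r then 1 else 0)
        with hf
      change ¬ (0 ≤ f j ∧ f j ≤ (n : ℤ) - 2 - ∑ i : Fin N, if i < j then f i else 0)
      have htot : ∑ i, f i = (n : ℤ) - 2 := by
        simp only [hf, Finset.sum_sub_distrib, Finset.sum_ite_eq', Finset.mem_univ, if_true]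
        rw [← hk]
        push_cast
        ring
      have hsum : ∑ i, f i = (∑ i : Fin N, if i < j then f i else 0) + f j + f r := by
        have h1 : f j = ∑ i, if i = j then f i else 0 := by simp
        have h2 : f r = ∑ i, if i = r then f i else 0 := by simp
        rw [h1, h2, ← Finset.sum_add_distrib, ← Finset.sum_add_distrib]
        refine Finset.sum_congr rfl fun i _ => ?_
        have hi : (i : ℕ) < N := i.2
        simp only [Fin.lt_def, Fin.ext_iff]
        split_ifs <;> omega
      have hfr : f r = -1 := by simp [hf, hr, hlr.ne']
      omega

end Counting

section Factorization

variable {n N : ℕ}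

theorem prod_inversionProd (hN : 2 ≤ N) (k : Fin N → ℕ) (hk : ∑ r, k r = n) (A : ℂ → ℂ → ℂ)
    (ζ : Fin n → ℂ) :
    ∏ E : {ε : Fin n → Fin N // hasContent ε k}, inversionProd A ζ E.1
      = (∏ i : Fin n, ∏ j : Fin n, if i < j then A (ζ i) (ζ j) else 1) ^ nExp N n k := by
  unfold inversionProd
  rw [Finset.prod_comm, ← Finset.prod_pow]
  refine Finset.prod_congr rfl fun a _ => ?_
  rw [Finset.prod_comm, ← Finset.prod_pow]
  refine Finset.prod_congr rfl fun b _ => ?_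
  by_cases hab : a < b
  · simp only [hab, true_and, if_true]
    rw [← Finset.prod_filter, Finset.prod_const, card_descents_eq_nExp hN k hk hab.ne]
  · simp [hab]

theorem update_update_swap (ε : Fin n → Fin N) {i j : Fin n} (hij : i ≠ j) :
    Function.update (Function.update ε i (ε j)) j (ε i) = ε ∘ Equiv.swap i j := by
  funext a
  simp only [Function.update_apply, Function.comp_apply, Equiv.swap_apply_def]
  split_ifs with h1 h2 <;> simp_all

/-- The parameters at which the exchange coefficients are regular and invertible. -/
def regularParams (n N : ℕ) (q : ℂ) : Set (Fin n → ℂ) :=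
  {ζ | (∀ t, ζ t ≠ 0) ∧ ∀ a b, a ≠ b → ζ a ^ N ≠ ζ b ^ N ∧ q ^ 2 * (ζ a / ζ b) ^ N ≠ 1}

theorem comp_mem_regularParams {q : ℂ} {ζ : Fin n → ℂ} (hζ : ζ ∈ regularParams n N q)
    (σ : Equiv.Perm (Fin n)) : ζ ∘ σ ∈ regularParams n N q :=
  ⟨fun _ => hζ.1 _, fun _ _ hab => hζ.2 _ _ fun h => hab (σ.injective h)⟩

theorem one_sub_ne_zero_of_regular {q : ℂ} {ζ : Fin n → ℂ} (hζ : ζ ∈ regularParams n N q)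
    {i j : Fin n} (hij : i ≠ j) :
    1 - (ζ i / ζ j) ^ N ≠ 0 ∧ 1 - q ^ 2 * (ζ i / ζ j) ^ N ≠ 0 := by
  refine ⟨fun h => (hζ.2 i j hij).1 ?_, fun h => (hζ.2 i j hij).2 (sub_eq_zero.1 h).symm⟩
  rw [sub_eq_zero, div_pow, eq_div_iff (pow_ne_zero _ (hζ.1 j)), one_mul] at h
  exact h.symm

theorem solve_exchange {A r b c L G H : ℂ} (hb : b ≠ 0) (hA : A * r * b = 1)
    (h : L = r * (b * G + c * H)) : G = A * L + -c / b * H := by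
  have hAr : A * r = b⁻¹ := eq_inv_of_mul_eq_one_left hA
  rw [h, ← mul_assoc A r, hAr]
  field_simp
  ring

theorem bFun_ne_zero {q x : ℂ} (hq : q ≠ 0) (h1 : 1 - x ^ N ≠ 0) (h2 : 1 - q ^ 2 * x ^ N ≠ 0) :
    bFun N q x ≠ 0 :=
  div_ne_zero (mul_ne_zero hq h1) h2

theorem a1Fun_mul_bFun {q u v : ℂ} (hq : q ≠ 0) (hu : u ≠ 0) (hv : v ≠ 0)
    (h1 : 1 - (u / v) ^ N ≠ 0) (h2 : 1 - q ^ 2 * (u / v) ^ N ≠ 0) :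
    a1Fun N q (u / v) * (v / u) ^ (N - 1) * bFun N q (u / v) = 1 := by
  have h3 : (u / v) ^ (N - 1) * (v / u) ^ (N - 1) = 1 := by
    rw [← mul_pow, div_mul_div_cancel₀ hv, div_self hu, one_pow]
  unfold a1Fun bFun
  generalize (u / v) ^ N = y at *
  field_simp
  exact h3

theorem a2Fun_mul_bFun {q u v : ℂ} (hN : 0 < N) (hq : q ≠ 0) (hu : u ≠ 0) (hv : v ≠ 0)
    (h1 : 1 - (u / v) ^ N ≠ 0) (h2 : 1 - q ^ 2 * (u / v) ^ N ≠ 0) :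
    a2Fun N q (u / v) * (u / v) ^ (N - 1) * bFun N q (u / v) = 1 := by
  have h3 : (u / v) ^ (1 - (N : ℤ)) * (u / v) ^ (N - 1) = 1 := by
    rw [← zpow_natCast, ← zpow_add₀ (div_ne_zero hu hv), Nat.cast_sub hN]
    simp
  unfold a2Fun bFun
  generalize (u / v) ^ N = y at *
  generalize (u / v) ^ (1 - (N : ℤ)) = z at *
  field_simp
  exact h3

end Factorization

/-- determinant factorization of `Ḡ`-type functions in terms of the
extremal component `f`. -/
theorem det_factorization (N : ℕ) (hN : 2 ≤ N) (q : ℂ) (hq : q ≠ 0)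
    (n : ℕ) (k : Fin N → ℕ) (hk : ∑ r : Fin N, k r = n)
    (g : (Fin n → ℂ) → (Fin n → ℂ) → (Fin n → Fin N) → (Fin n → Fin N) → ℂ)
    (hexζ : ∀ (ζ : Fin n → ℂ) (ξ : Fin n → ℂ), (∀ t, ζ t ≠ 0) → (∀ t, ξ t ≠ 0) →
      ∀ (i : Fin n) (hi : (i : ℕ) + 1 < n) (ε : Fin n → Fin N) (μ : Fin n → Fin N)
        (α β : Fin N),
        (α ≠ β →
          g (fun t => ζ (Equiv.swap i ⟨(i : ℕ) + 1, hi⟩ t)) ξ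
              (Function.update (Function.update ε i α) ⟨(i : ℕ) + 1, hi⟩ β) μ
            = (ζ ⟨(i : ℕ) + 1, hi⟩ / ζ i) ^ (N - 1)
              * (bFun N q (ζ i / ζ ⟨(i : ℕ) + 1, hi⟩)
                    * g ζ ξ (Function.update (Function.update ε i β)
                        ⟨(i : ℕ) + 1, hi⟩ α) μ
                  + cFun N q α β (ζ i / ζ ⟨(i : ℕ) + 1, hi⟩)
                    * g ζ ξ (Function.update (Function.update ε i α)
                        ⟨(i : ℕ) + 1, hi⟩ β) μ))
        ∧ g (fun t => ζ (Equiv.swap i ⟨(i : ℕ) + 1, hi⟩ t)) ξ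
              (Function.update (Function.update ε i α) ⟨(i : ℕ) + 1, hi⟩ α) μ
            = (ζ ⟨(i : ℕ) + 1, hi⟩ / ζ i) ^ (N - 1)
              * g ζ ξ (Function.update (Function.update ε i α) ⟨(i : ℕ) + 1, hi⟩ α) μ)
    (hexξ : ∀ (ζ : Fin n → ℂ) (ξ : Fin n → ℂ), (∀ t, ζ t ≠ 0) → (∀ t, ξ t ≠ 0) →
      ∀ (i : Fin n) (hi : (i : ℕ) + 1 < n) (ε : Fin n → Fin N) (μ : Fin n → Fin N)
        (α β : Fin N),
        (α ≠ β →
          g ζ (fun t => ξ (Equiv.swap i ⟨(i : ℕ) + 1, hi⟩ t)) ε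
              (Function.update (Function.update μ i α) ⟨(i : ℕ) + 1, hi⟩ β)
            = (ξ i / ξ ⟨(i : ℕ) + 1, hi⟩) ^ (N - 1)
              * (bFun N q (ξ i / ξ ⟨(i : ℕ) + 1, hi⟩)
                    * g ζ ξ ε (Function.update (Function.update μ i β)
                        ⟨(i : ℕ) + 1, hi⟩ α)
                  + cFun N q β α (ξ i / ξ ⟨(i : ℕ) + 1, hi⟩)
                    * g ζ ξ ε (Function.update (Function.update μ i α)
                        ⟨(i : ℕ) + 1, hi⟩ β)))
        ∧ g ζ (fun t => ξ (Equiv.swap i ⟨(i : ℕ) + 1, hi⟩ t)) ε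
              (Function.update (Function.update μ i α) ⟨(i : ℕ) + 1, hi⟩ α)
            = (ξ i / ξ ⟨(i : ℕ) + 1, hi⟩) ^ (N - 1)
              * g ζ ξ ε (Function.update (Function.update μ i α) ⟨(i : ℕ) + 1, hi⟩ α))
    (ζ ξ : Fin n → ℂ) (hζ : ∀ t, ζ t ≠ 0) (hξ : ∀ t, ξ t ≠ 0)
    (hz : ∀ a b : Fin n, a ≠ b → ζ a ^ N ≠ ζ b ^ N)
    (hu : ∀ a b : Fin n, a ≠ b → ξ a ^ N ≠ ξ b ^ N)
    (hqz : ∀ a b : Fin n, a ≠ b → q ^ 2 * (ζ a / ζ b) ^ N ≠ 1)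
    (hqu : ∀ a b : Fin n, a ≠ b → q ^ 2 * (ξ a / ξ b) ^ N ≠ 1) :
    Matrix.det
        (Matrix.of fun E M : {ε : Fin n → Fin N // hasContent ε k} => g ζ ξ E.1 M.1)
      = (∏ i : Fin n, ∏ j : Fin n,
            if i < j then a1Fun N q (ζ i / ζ j) * a2Fun N q (ξ i / ξ j) else 1)
            ^ nExp N n k
        * Matrix.det
            (Matrix.of fun E M : {ε : Fin n → Fin N // hasContent ε k} =>
              g (fun t => ζ (Tuple.sort E.1 t)) (fun t => ξ (Tuple.sort M.1 t))
                (minSeq N n (by omega) k) (minSeq N n (by omega) k)) := by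
  have hN0 : 0 < N := by omega
  have hζG : ζ ∈ regularParams n N q := ⟨hζ, fun a b hab => ⟨hz a b hab, hqz a b hab⟩⟩
  have hξG : ξ ∈ regularParams n N q := ⟨hξ, fun a b hab => ⟨hu a b hab, hqu a b hab⟩⟩
  have hex₁ : ∀ ξ : Fin n → ℂ, (∀ t, ξ t ≠ 0) → ∀ μ, IsExchange
      (fun u v => a1Fun N q (u / v))
      (fun α β u v => -cFun N q α β (u / v) / bFun N q (u / v))
      (fun u v => (v / u) ^ (N - 1)) (regularParams n N q) (fun ζ ε => g ζ ξ ε μ) := by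
    intro ξ hξ μ ζ hζ i j hij ε
    have hi : (i : ℕ) + 1 < n := hij ▸ j.2
    have hj : (⟨i + 1, hi⟩ : Fin n) = j := Fin.ext hij.symm
    have hne : i ≠ j := fun h => by rw [h] at hij; omega
    obtain ⟨h1, h2⟩ := one_sub_ne_zero_of_regular hζ hne
    have hex := hexζ ζ ξ hζ.1 hξ i hi ε μ
    simp only [hj] at hex
    constructor
    · intro hlt
      have e := (hex (ε j) (ε i)).1 hlt.ne
      rw [update_update_swap ε hne, Function.update_eq_self, Function.update_eq_self] at e
      exact solve_exchange (bFun_ne_zero hq h1 h2)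
        (a1Fun_mul_bFun hq (hζ.1 i) (hζ.1 j) h1 h2) e
    · intro heq
      have e := (hex (ε i) (ε i)).2
      rwa [Function.update_eq_self, heq, Function.update_eq_self] at e
  have hex₂ : ∀ ζ : Fin n → ℂ, (∀ t, ζ t ≠ 0) → ∀ ε, IsExchange
      (fun u v => a2Fun N q (u / v))
      (fun α β u v => -cFun N q β α (u / v) / bFun N q (u / v))
      (fun u v => (u / v) ^ (N - 1)) (regularParams n N q) (fun ξ μ => g ζ ξ ε μ) := by
    intro ζ hζ ε ξ hξ i j hij μ
    have hi : (i : ℕ) + 1 < n := hij ▸ j.2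
    have hj : (⟨i + 1, hi⟩ : Fin n) = j := Fin.ext hij.symm
    have hne : i ≠ j := fun h => by rw [h] at hij; omega
    obtain ⟨h1, h2⟩ := one_sub_ne_zero_of_regular hξ hne
    have hex := hexξ ζ ξ hζ hξ.1 i hi ε μ
    simp only [hj] at hex
    constructor
    · intro hlt
      have e := (hex (μ j) (μ i)).1 hlt.ne
      rw [update_update_swap μ hne, Function.update_eq_self, Function.update_eq_self] at e
      exact solve_exchange (bFun_ne_zero hq h1 h2)
        (a2Fun_mul_bFun hN0 hq (hξ.1 i) (hξ.1 j) h1 h2) e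
    · intro heq
      have e := (hex (μ i) (μ i)).2
      rwa [Function.update_eq_self, heq, Function.update_eq_self] at e
  choose T₁ hT₁ hd₁ he₁ using fun E => exists_triangular_expansion hN0 k
    (fun u v => a1Fun N q (u / v)) (fun α β u v => -cFun N q α β (u / v) / bFun N q (u / v))
    (fun u v => (v / u) ^ (N - 1)) (regularParams n N q)
    (fun ζ hζ σ => comp_mem_regularParams hζ σ) E ζ hζG
  choose T₂ hT₂ hd₂ he₂ using fun E => exists_triangular_expansion hN0 k
    (fun u v => a2Fun N q (u / v)) (fun α β u v => -cFun N q β α (u / v) / bFun N q (u / v))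
    (fun u v => (u / v) ^ (N - 1)) (regularParams n N q)
    (fun ζ hζ σ => comp_mem_regularParams hζ σ) E ξ hξG
  have hfactor : (Matrix.of fun E M : {ε : Fin n → Fin N // hasContent ε k} => g ζ ξ E.1 M.1)
      = Matrix.of T₁ * (Matrix.of fun E M : {ε : Fin n → Fin N // hasContent ε k} =>
          g (fun t => ζ (Tuple.sort E.1 t)) (fun t => ξ (Tuple.sort M.1 t))
            (minSeq N n hN0 k) (minSeq N n hN0 k)) * (Matrix.of T₂).transpose := by
    ext E M
    simp only [Matrix.of_apply, Matrix.mul_apply, Matrix.transpose_apply, Finset.sum_mul]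
    rw [he₁ E _ (hex₁ ξ hξ M.1), Finset.sum_comm]
    refine Finset.sum_congr rfl fun D _ => ?_
    rw [he₂ M _ (hex₂ (ζ ∘ Tuple.sort D.1) (fun t => hζ _) (minSeq N n hN0 k)), Finset.mul_sum]
    refine Finset.sum_congr rfl fun D' _ => ?_
    simp only [Function.comp_def]
    ring
  have hprod : (∏ i : Fin n, ∏ j : Fin n,
        if i < j then a1Fun N q (ζ i / ζ j) * a2Fun N q (ξ i / ξ j) else 1)
      = (∏ i : Fin n, ∏ j : Fin n, if i < j then a1Fun N q (ζ i / ζ j) else 1)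
        * ∏ i : Fin n, ∏ j : Fin n, if i < j then a2Fun N q (ξ i / ξ j) else 1 := by
    simp only [← Finset.prod_mul_distrib]
    refine Finset.prod_congr rfl fun i _ => Finset.prod_congr rfl fun j _ => ?_
    split_ifs <;> simp
  rw [hfactor, Matrix.det_mul, Matrix.det_mul, Matrix.det_transpose,
    det_of_dominated (Matrix.of T₁) hT₁, det_of_dominated (Matrix.of T₂) hT₂]
  simp only [Matrix.of_apply, hd₁, hd₂]
  rw [prod_inversionProd hN k hk, prod_inversionProd hN k hk, hprod, mul_pow]
  ring
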